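/- Fix c ∈ (0,1), and let d : ℕ → ℕ be any sequence with d(n) → ∞, log d(n) / log n → 0, and n·d(n) even for all n. Then as n → ∞ the ratio (-log(|G_{d(n),c}(n)| / |G_{d(n)}(n)|)) / ((d(n)·n/2)·log(n/(d(n)+1))) converges to c. -/

import Mathlib

open Filter

/-- The number of `k`-cliques (sets of `k` mutually adjacent vertices) in a graph. -/
noncomputable def cliqueCount {V : Type*} (G : SimpleGraph V) (k : ℕ) : ℕ :=
  Nat.card {t : Finset V // G.IsNClique k t}

/-- A graph is `d`-regular: every vertex has degree exactly `d`. -/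
def IsDRegular {V : Type*} (G : SimpleGraph V) (d : ℕ) : Prop :=
  ∀ v : V, (G.neighborSet v).ncard = d

/-- `G_{d,c}(n)`: the set of simple `d`-regular graphs on the labeled vertex set `Fin n`
with at least `c * T_max` triangles, where `T_max = (n/3) * choose d 2`. -/
noncomputable def Gdc (n d : ℕ) (c : ℝ) : Set (SimpleGraph (Fin n)) :=
  {G | IsDRegular G d ∧ c * ((n : ℝ) / 3 * (d.choose 2)) ≤ (cliqueCount G 3 : ℝ)}

/-- `G_d(n)`: the set of all simple `d`-regular graphs on the labeled vertex set `Fin n`. -/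
def Gd (n d : ℕ) : Set (SimpleGraph (Fin n)) := {G | IsDRegular G d}

open Classical in
/-- The edges of `G` spanned by the neighbourhood of `w`. -/
noncomputable def linkEdges {V : Type*} [Fintype V] (G : SimpleGraph V) (w : V) :
    Finset (Sym2 V) :=
  G.edgeFinset.filter fun e => ∀ v ∈ e, G.Adj w v

lemma mem_linkEdges {V : Type*} [Fintype V] {G : SimpleGraph V} {w : V} {e : Sym2 V} :
    e ∈ linkEdges G w ↔ e ∈ G.edgeSet ∧ ∀ v ∈ e, G.Adj w v := by
  simp [linkEdges]

lemma IsDRegular.degree_eq {V : Type*} {G : SimpleGraph V} {d : ℕ} (hG : IsDRegular G d) (v : V)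
    [Fintype (G.neighborSet v)] : G.degree v = d := by
  rw [← hG v, SimpleGraph.degree, ← Set.ncard_coe_finset, SimpleGraph.coe_neighborFinset]

lemma card_filter_card_le_le {α : Type*} (s : Finset α) {x : ℝ} (hx0 : 0 < x) (hx1 : x ≤ 1)
    (M : ℝ) : ((s.powerset.filter fun t => (t.card : ℝ) ≤ M).card : ℝ) ≤
      x ^ (-M) * Real.exp (x * s.card) := by
  calc ((s.powerset.filter fun t => (t.card : ℝ) ≤ M).card : ℝ)
      = ∑ t ∈ s.powerset.filter fun t => (t.card : ℝ) ≤ M, (1 : ℝ) := by simp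
    _ ≤ ∑ t ∈ s.powerset.filter fun t => (t.card : ℝ) ≤ M, x ^ (-M) * x ^ t.card := by
        refine Finset.sum_le_sum fun t ht => ?_
        rw [← Real.rpow_natCast, ← Real.rpow_add hx0]
        exact Real.one_le_rpow_of_pos_of_le_one_of_nonpos hx0 hx1
          (by linarith [(Finset.mem_filter.1 ht).2])
    _ ≤ ∑ t ∈ s.powerset, x ^ (-M) * x ^ t.card :=
        Finset.sum_le_sum_of_subset_of_nonneg (Finset.filter_subset _ _)
          fun _ _ _ => by positivity
    _ = x ^ (-M) * (x + 1) ^ s.card := by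
        rw [← Finset.mul_sum, ← Finset.sum_pow_mul_eq_add_pow]
        simp
    _ ≤ x ^ (-M) * Real.exp (x * s.card) := by
        gcongr
        rw [mul_comm x, Real.exp_nat_mul]
        gcongr
        exact Real.add_one_le_exp x

lemma three_mul_cliqueCount_le {V : Type*} [Fintype V] (G : SimpleGraph V) :
    3 * cliqueCount G 3 ≤ ∑ w, (linkEdges G w).card := by
  classical
  have hT : cliqueCount G 3 = (G.cliqueFinset 3).card := by
    rw [cliqueCount, Nat.card_eq_fintype_card, Fintype.card_subtype]
    congr 1
  have h3 : 3 * cliqueCount G 3 = ((G.cliqueFinset 3).sigma fun t => t).card := by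
    rw [Finset.card_sigma, Finset.sum_congr rfl (fun t ht =>
      ((SimpleGraph.mem_cliqueFinset_iff).1 ht).card_eq), hT]
    simp [mul_comm]
  rw [h3, ← Finset.card_sigma]
  refine Finset.card_le_card_of_surjOn (fun p => ⟨insert p.1 p.2.toFinset, p.1⟩) ?_
  rintro ⟨t, w⟩ h
  simp only [Finset.coe_sigma, Set.mem_sigma_iff, Finset.mem_coe,
    SimpleGraph.mem_cliqueFinset_iff] at h
  obtain ⟨ht, hw⟩ := h
  have hcard : (t.erase w).card = 2 := by rw [Finset.card_erase_of_mem hw, ht.card_eq]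
  obtain ⟨a, b, hab, he⟩ := Finset.card_eq_two.1 hcard
  have ha : a ∈ t.erase w := by simp [he]
  have hb : b ∈ t.erase w := by simp [he]
  rw [Finset.mem_erase] at ha hb
  refine ⟨⟨w, s(a, b)⟩, ?_, ?_⟩
  · simp only [mem_linkEdges, Finset.coe_sigma, Set.mem_sigma_iff, Finset.coe_univ, Set.mem_univ,
      true_and, Finset.mem_coe,
      SimpleGraph.mem_edgeSet, Sym2.mem_iff]
    refine ⟨ht.isClique ha.2 hb.2 hab, ?_⟩
    rintro v (rfl | rfl)
    · exact ht.isClique hw ha.2 (Ne.symm ha.1)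
    · exact ht.isClique hw hb.2 (Ne.symm hb.1)
  · have : insert w (s(a, b) : Sym2 V).toFinset = t := by
      rw [← Finset.insert_erase hw, he]
      ext; simp
    simp only [this]

lemma card_filter_mem_linkEdges_le {V : Type*} [Fintype V] [DecidableEq V] {G : SimpleGraph V} {d : ℕ}
    (hG : IsDRegular G d) {e : Sym2 V} (he : e ∈ G.edgeSet) :
    (Finset.univ.filter fun w => e ∈ linkEdges G w).card ≤ d - 1 := by
  classical
  induction e with
  | _ a b =>
    rw [SimpleGraph.mem_edgeSet] at he
    have hd : (G.neighborFinset a).card = d := hG.degree_eq a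
    have hb : b ∈ G.neighborFinset a := by simpa using he
    rw [← hd, ← Finset.card_erase_of_mem hb]
    refine Finset.card_le_card fun w hw => ?_
    simp only [mem_linkEdges, Finset.mem_filter, Finset.mem_univ, true_and, Sym2.mem_iff] at hw
    have h1 := hw.2 a (Or.inl rfl)
    have h2 := hw.2 b (Or.inr rfl)
    simp [h1.symm, h2.ne]

lemma two_mul_card_edgeFinset_of_isDRegular {V : Type*} [Fintype V] {G : SimpleGraph V}
    [Fintype G.edgeSet] {d : ℕ} (hG : IsDRegular G d) :
    2 * G.edgeFinset.card = Fintype.card V * d := by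
  classical
  have h := G.sum_degrees_eq_twice_card_edges
  simp only [hG.degree_eq, Finset.sum_const, Finset.card_univ, smul_eq_mul] at h
  rw [h]
  congr!

/-- A `d`-regular graph with many triangles has a small vertex set `S` such that most edges are
spanned by the neighbourhood of some vertex of `S`. -/
lemma exists_small_cover {V : Type*} [Fintype V] [DecidableEq V] {G : SimpleGraph V}
    [Fintype G.edgeSet] {d : ℕ} (hd : 2 ≤ d) (hG : IsDRegular G d) {c : ℝ}
    (hc : c * ((Fintype.card V : ℝ) / 3 * (d.choose 2)) ≤ (cliqueCount G 3 : ℝ))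
    {K : ℝ} (hK : 0 < K) :
    ∃ S : Finset V, (S.card : ℝ) * K ≤ d * Fintype.card V / 2 ∧
      ((G.edgeFinset \ S.biUnion (linkEdges G)).card : ℝ) ≤
        (1 - c) * (d * Fintype.card V / 2) + Fintype.card V * K / (d - 1) := by
  set n := (Fintype.card V : ℝ) with hn
  have hE : (G.edgeFinset.card : ℝ) = d * n / 2 := by
    have := two_mul_card_edgeFinset_of_isDRegular hG
    have h : (2 : ℝ) * G.edgeFinset.card = n * d := by rw [hn]; exact_mod_cast this
    linarith
  have hsub (S : Finset V) : S.biUnion (linkEdges G) ⊆ G.edgeFinset := by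
    intro e he
    obtain ⟨w, -, hw⟩ := Finset.mem_biUnion.1 he
    simpa using (mem_linkEdges.1 hw).1
  obtain ⟨S, -, hS⟩ := Finset.exists_max_image (Finset.univ : Finset (Finset V))
    (fun S => ((S.biUnion (linkEdges G)).card : ℝ) - K * S.card) ⟨∅, Finset.mem_univ _⟩
  set C := S.biUnion (linkEdges G) with hC
  have hCE : (C.card : ℝ) ≤ d * n / 2 := by
    rw [← hE]; exact_mod_cast Finset.card_le_card (hsub S)
  refine ⟨S, ?_, ?_⟩
  · have := hS ∅ (Finset.mem_univ _)
    simp only [Finset.biUnion_empty, Finset.card_empty, Nat.cast_zero, mul_zero, sub_zero] at this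
    linarith
  have hgain (w : V) : ((linkEdges G w \ C).card : ℝ) ≤ K := by
    have h1 := hS (insert w S) (Finset.mem_univ _)
    rw [Finset.biUnion_insert, ← hC, ← Finset.sdiff_union_self_eq_union,
      Finset.card_union_of_disjoint Finset.sdiff_disjoint] at h1
    have h2 : ((insert w S).card : ℝ) ≤ S.card + 1 := by exact_mod_cast Finset.card_insert_le w S
    push_cast at h1
    nlinarith
  have hin : ∑ w, (linkEdges G w ∩ C).card ≤ C.card * (d - 1) := by
    have h := Finset.sum_card_bipartiteAbove_eq_sum_card_bipartiteBelow
      (s := (Finset.univ : Finset V)) (t := C) (fun w e => e ∈ linkEdges G w)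
    have h' : ∀ w, linkEdges G w ∩ C = C.bipartiteAbove (fun w e => e ∈ linkEdges G w) w := by
      intro w; ext e; simp [Finset.bipartiteAbove, and_comm]
    simp only [h', h]
    refine Finset.sum_le_card_nsmul _ _ _ fun e he => ?_
    exact card_filter_mem_linkEdges_le hG (by simpa using hsub S he)
  have hsum : (3 : ℝ) * cliqueCount G 3 ≤ n * K + C.card * (d - 1) := by
    have h3 : (3 : ℝ) * cliqueCount G 3 ≤ ∑ w, ((linkEdges G w).card : ℝ) := by
      exact_mod_cast three_mul_cliqueCount_le G
    have hin' : ∑ w, ((linkEdges G w ∩ C).card : ℝ) ≤ C.card * (d - 1) := by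
      rw [← Nat.cast_pred (by omega : 0 < d)]
      exact_mod_cast hin
    have hout : ∑ w, ((linkEdges G w \ C).card : ℝ) ≤ n * K := by
      have := Finset.sum_le_card_nsmul Finset.univ _ _ fun w _ => hgain w
      simpa [hn] using this
    have hsplit : ∑ w, ((linkEdges G w).card : ℝ) =
        ∑ w, ((linkEdges G w \ C).card : ℝ) + ∑ w, ((linkEdges G w ∩ C).card : ℝ) := by
      rw [← Finset.sum_add_distrib]
      exact Finset.sum_congr rfl fun w _ => by
        exact_mod_cast (Finset.card_sdiff_add_card_inter _ _).symm
    linarith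
  have hd1 : (0 : ℝ) < d - 1 := by
    have : (2 : ℝ) ≤ d := by exact_mod_cast hd
    linarith
  have hcard : ((G.edgeFinset \ C).card : ℝ) = d * n / 2 - C.card := by
    rw [Finset.cast_card_sdiff (hsub S), hE]
  rw [hcard]
  rw [Nat.cast_choose_two] at hc
  have hmain : c * (d * n / 2) - n * K / (d - 1) ≤ C.card := by
    rw [sub_le_iff_le_add, ← sub_le_iff_le_add', le_div_iff₀ hd1]
    linarith
  linarith

/-- The pairs of vertices contained in the neighbourhood, in the graph with edge set `U`, of some
vertex of `S`. -/
def spannedPairs {V : Type*} [Fintype V] [DecidableEq V] (S : Finset V) (U : Finset (Sym2 V)) :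
    Finset (Sym2 V) :=
  S.biUnion fun s => (Finset.univ.filter fun v => s(s, v) ∈ U).sym2

/-- Every `d`-regular graph with many triangles is determined by a small vertex set `S`, a set `U`
of at most `M` edges, and a subset `W` of the pairs spanned by `S` and `U`. -/
lemma exists_code {V : Type*} [Fintype V] [DecidableEq V] {G : SimpleGraph V}
    [Fintype G.edgeSet] {d : ℕ} (hd : 2 ≤ d) (hG : IsDRegular G d) {c : ℝ}
    (hc : c * ((Fintype.card V : ℝ) / 3 * (d.choose 2)) ≤ (cliqueCount G 3 : ℝ))
    {K : ℝ} (hK : 0 < K) :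
    ∃ (S : Finset V) (U W : Finset (Sym2 V)), G.edgeFinset = U ∪ W ∧
      (S.card : ℝ) ≤ d * Fintype.card V / 2 / K ∧
      (U.card : ℝ) ≤ (1 - c) * (d * Fintype.card V / 2) + Fintype.card V * K / (d - 1) +
        d * Fintype.card V / 2 / K * d ∧
      (W.card : ℝ) ≤ d * Fintype.card V / 2 ∧
      W ⊆ spannedPairs S U ∧
      ∀ s ∈ S, (Finset.univ.filter fun v => s(s, v) ∈ U).card ≤ d := by
  classical
  obtain ⟨S, hSK, hS⟩ := exists_small_cover hd hG hc hK
  set C := S.biUnion (linkEdges G) with hC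
  have hCE : C ⊆ G.edgeFinset := by
    intro e he
    obtain ⟨w, -, hw⟩ := Finset.mem_biUnion.1 he
    simpa using (mem_linkEdges.1 hw).1
  have hScard : (S.card : ℝ) ≤ d * Fintype.card V / 2 / K := by rwa [le_div_iff₀ hK]
  set I := S.biUnion fun s => G.incidenceFinset s with hI
  have hIE : I ⊆ G.edgeFinset := by
    intro e he
    obtain ⟨w, -, hw⟩ := Finset.mem_biUnion.1 he
    exact G.incidenceFinset_subset w hw
  have hIcard : (I.card : ℝ) ≤ d * Fintype.card V / 2 / K * d := by
    have h : I.card ≤ S.card * d :=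
      Finset.card_biUnion_le_card_mul _ _ _ fun s _ => by
        rw [SimpleGraph.card_incidenceFinset_eq_degree, hG.degree_eq]
    calc (I.card : ℝ) ≤ S.card * d := by exact_mod_cast h
      _ ≤ _ := by gcongr
  have hnbr (s : V) (hs : s ∈ S) (v : V) : s(s, v) ∈ G.edgeFinset \ C ∪ I ↔ G.Adj s v := by
    constructor
    · intro h
      have : s(s, v) ∈ G.edgeFinset := by
        rcases Finset.mem_union.1 h with h | h
        · exact (Finset.mem_sdiff.1 h).1
        · exact hIE h
      simpa using this
    · intro h
      refine Finset.mem_union_right _ (Finset.mem_biUnion.2 ⟨s, hs, ?_⟩)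
      simpa using h
  refine ⟨S, G.edgeFinset \ C ∪ I, C, ?_, hScard, ?_, ?_, ?_, ?_⟩
  · rw [Finset.union_right_comm, Finset.sdiff_union_of_subset hCE,
      Finset.union_eq_left.2 hIE]
  · calc ((G.edgeFinset \ C ∪ I).card : ℝ) ≤ (G.edgeFinset \ C).card + I.card := by
          exact_mod_cast Finset.card_union_le _ _
      _ ≤ _ := add_le_add hS hIcard
  · have h1 : (2 : ℝ) * G.edgeFinset.card = Fintype.card V * d := by
      exact_mod_cast two_mul_card_edgeFinset_of_isDRegular hG
    have h2 : (C.card : ℝ) ≤ G.edgeFinset.card := by exact_mod_cast Finset.card_le_card hCE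
    linarith
  · intro e he
    obtain ⟨s, hs, hes⟩ := Finset.mem_biUnion.1 he
    refine Finset.mem_biUnion.2 ⟨s, hs, Finset.mem_sym2_iff.2 fun v hv => ?_⟩
    simp only [Finset.mem_filter, Finset.mem_univ, true_and]
    exact (hnbr s hs v).2 ((mem_linkEdges.1 hes).2 v hv)
  · intro s hs
    rw [← hG.degree_eq s, SimpleGraph.degree]
    refine Finset.card_le_card fun v hv => ?_
    simpa using (hnbr s hs v).1 (Finset.mem_filter.1 hv).2

lemma card_Gdc_le {n d : ℕ} (hn : 1 ≤ n) (hd : 2 ≤ d) (c : ℝ) {K : ℝ} (hK : 0 < K) :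
    (Nat.card (Gdc n d c) : ℝ) ≤ 2 ^ n *
      (((n : ℝ) ^ ((1 - c) * (d * n / 2) + n * K / (d - 1) + d * n / 2 / K * d) * Real.exp n) *
        ((d : ℝ) ^ ((d : ℝ) * n / 2) * Real.exp (d * n / 2 / K * d))) := by
  classical
  set Q : ℝ := (d : ℝ) * n / 2 with hQ
  set M : ℝ := (1 - c) * Q + n * K / (d - 1) + Q / K * d with hM
  have hn' : (1 : ℝ) ≤ n := by exact_mod_cast hn
  have hd' : (2 : ℝ) ≤ d := by exact_mod_cast hd
  set 𝒮 := (Finset.univ : Finset (Finset (Fin n))).filter fun S => (S.card : ℝ) ≤ Q / K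
  set 𝒰 : Finset (Fin n) → Finset (Finset (Sym2 (Fin n))) := fun S =>
    ((Finset.univ : Finset (Sym2 (Fin n))).powerset.filter fun U => (U.card : ℝ) ≤ M).filter
      fun U => ∀ s ∈ S, (Finset.univ.filter fun v => s(s, v) ∈ U).card ≤ d
  set 𝒲 : Finset (Fin n) → Finset (Sym2 (Fin n)) → Finset (Finset (Sym2 (Fin n))) := fun S U =>
    (spannedPairs S U).powerset.filter fun W => (W.card : ℝ) ≤ Q
  set B := 𝒮.biUnion fun S => (𝒰 S).biUnion fun U => (𝒲 S U).image fun W => U ∪ W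
  have hGB : Nat.card (Gdc n d c) ≤ B.card := by
    rw [← Nat.card_eq_finsetCard]
    refine Nat.card_le_card_of_injective
      (fun G : Gdc n d c => (⟨G.1.edgeFinset, ?_⟩ : B)) fun G H h => ?_
    · obtain ⟨hG, hc⟩ := G.2
      obtain ⟨S, U, W, h, hS, hU, hW, hWs, hdeg⟩ := exists_code hd hG
        (by rwa [Fintype.card_fin]) hK
      rw [Fintype.card_fin] at hS hU hW
      rw [h]
      simp only [B, 𝒮, 𝒰, 𝒲, Finset.mem_biUnion, Finset.mem_image, Finset.mem_filter,
        Finset.mem_univ, true_and, Finset.mem_powerset, Finset.subset_univ]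
      exact ⟨S, hS, U, ⟨hU, hdeg⟩, W, ⟨hWs, hW⟩, rfl⟩
    · exact Subtype.ext (SimpleGraph.edgeFinset_inj.1 (Subtype.mk.inj h))
  have hSc : (𝒮.card : ℝ) ≤ 2 ^ n := by
    have : 𝒮.card ≤ 2 ^ n := by
      simpa using Finset.card_le_univ 𝒮
    exact_mod_cast this
  have hUc (S) : ((𝒰 S).card : ℝ) ≤ (n : ℝ) ^ M * Real.exp n := by
    calc ((𝒰 S).card : ℝ) ≤ _ := Nat.cast_le.2 (Finset.card_filter_le _ _)
      _ ≤ (n : ℝ)⁻¹ ^ (-M) * Real.exp ((n : ℝ)⁻¹ * (Finset.univ : Finset (Sym2 (Fin n))).card) :=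
        card_filter_card_le_le _ (by positivity) (inv_le_one_of_one_le₀ hn') M
      _ ≤ _ := by
        rw [Real.inv_rpow (by positivity), Real.rpow_neg (by positivity), inv_inv]
        gcongr
        rw [inv_mul_le_iff₀ (by positivity), Finset.card_univ, Sym2.card, Fintype.card_fin,
          Nat.cast_choose_two]
        push_cast
        nlinarith
  have hWc (S) (hS : S ∈ 𝒮) (U) (hU : U ∈ 𝒰 S) :
      ((𝒲 S U).card : ℝ) ≤ (d : ℝ) ^ Q * Real.exp (Q / K * d) := by
    have hP : (spannedPairs S U).card ≤ S.card * d ^ 2 := by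
      refine Finset.card_biUnion_le_card_mul _ _ _ fun s hs => ?_
      rw [Finset.card_sym2]
      refine (Nat.choose_le_choose 2
        (Nat.add_le_add_right ((Finset.mem_filter.1 hU).2 s hs) 1)).trans ?_
      rw [Nat.choose_two_right]
      refine Nat.div_le_of_le_mul ?_
      simp only [Nat.add_sub_cancel]
      nlinarith
    have hP' : ((spannedPairs S U).card : ℝ) ≤ Q / K * d ^ 2 := by
      calc ((spannedPairs S U).card : ℝ) ≤ S.card * d ^ 2 := by exact_mod_cast hP
        _ ≤ _ := by gcongr; exact (Finset.mem_filter.1 hS).2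
    calc ((𝒲 S U).card : ℝ)
        ≤ (d : ℝ)⁻¹ ^ (-Q) * Real.exp ((d : ℝ)⁻¹ * (spannedPairs S U).card) :=
        card_filter_card_le_le _ (by positivity) (inv_le_one_of_one_le₀ (by linarith)) Q
      _ ≤ _ := by
        rw [Real.inv_rpow (by positivity), Real.rpow_neg (by positivity), inv_inv]
        refine mul_le_mul_of_nonneg_left (Real.exp_le_exp.2 ?_) (by positivity)
        rw [inv_mul_le_iff₀ (by positivity)]
        linarith
  set X := (n : ℝ) ^ M * Real.exp n
  set Y := (d : ℝ) ^ Q * Real.exp (Q / K * d)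
  calc (Nat.card (Gdc n d c) : ℝ) ≤ B.card := by exact_mod_cast hGB
    _ ≤ ∑ S ∈ 𝒮, ∑ U ∈ 𝒰 S, ((𝒲 S U).card : ℝ) := by
      have : B.card ≤ ∑ S ∈ 𝒮, ∑ U ∈ 𝒰 S, (𝒲 S U).card :=
        Finset.card_biUnion_le.trans <| Finset.sum_le_sum fun S _ =>
          Finset.card_biUnion_le.trans <| Finset.sum_le_sum fun U _ => Finset.card_image_le
      exact_mod_cast this
    _ ≤ ∑ S ∈ 𝒮, ∑ U ∈ 𝒰 S, Y :=
      Finset.sum_le_sum fun S hS => Finset.sum_le_sum fun U hU => hWc S hS U hU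
    _ ≤ ∑ S ∈ 𝒮, X * Y := by
      refine Finset.sum_le_sum fun S _ => ?_
      rw [Finset.sum_const, nsmul_eq_mul]
      gcongr
      exact hUc S
    _ ≤ 2 ^ n * (X * Y) := by
      rw [Finset.sum_const, nsmul_eq_mul]
      gcongr

lemma exists_isDRegular_of_symm {r d : ℕ} (A : Finset ℕ) (hA : A ⊆ Finset.Ico 1 r)
    (hsymm : ∀ x ∈ A, r - x ∈ A) (hcard : A.card = d) :
    ∃ G : SimpleGraph (Fin r), IsDRegular G d := by
  rcases Nat.eq_zero_or_pos r with rfl | hr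
  · exact ⟨⊥, fun v => v.elim0⟩
  have : NeZero r := ⟨hr.ne'⟩
  have hneg (x : Fin r) (hx : (x : ℕ) ∈ A) : ((-x : Fin r) : ℕ) ∈ A := by
    have h := Finset.mem_Ico.1 (hA hx)
    rw [Fin.val_neg', Nat.mod_eq_of_lt (by omega)]
    exact hsymm _ hx
  refine ⟨{ Adj := fun u v => ((v - u : Fin r) : ℕ) ∈ A
            symm := ⟨fun u v h => by simpa using hneg _ h⟩
            loopless := ⟨fun u h => by
              have := Finset.mem_Ico.1 (hA h)
              simp at this⟩ }, fun v => ?_⟩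
  rw [← hcard, ← Set.ncard_coe_finset A]
  refine Set.ncard_congr (fun u _ => ((u - v : Fin r) : ℕ)) (fun u hu => hu) ?_ ?_
  · intro a b _ _ h
    exact sub_left_injective (Fin.ext h)
  · intro x hx
    have h := Finset.mem_Ico.1 (hA hx)
    refine ⟨⟨x, h.2⟩ + v, ?_, ?_⟩
    · change ((⟨x, h.2⟩ + v - v : Fin r) : ℕ) ∈ A
      simpa using hx
    · simp

lemma exists_isDRegular {r d : ℕ} (hdr : d + 1 ≤ r) (he : Even (r * d)) :
    ∃ G : SimpleGraph (Fin r), IsDRegular G d := by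
  rcases Nat.even_or_odd' d with ⟨k, rfl | rfl⟩
  · refine exists_isDRegular_of_symm (Finset.Icc 1 k ∪ Finset.Ico (r - k) r) ?_ ?_ ?_
    · intro x hx
      simp only [Finset.mem_union, Finset.mem_Icc, Finset.mem_Ico] at hx ⊢
      omega
    · intro x hx
      simp only [Finset.mem_union, Finset.mem_Icc, Finset.mem_Ico] at hx ⊢
      omega
    · rw [Finset.card_union_of_disjoint, Nat.card_Icc, Nat.card_Ico]
      · omega
      · rw [Finset.disjoint_left]
        intro x hx
        simp only [Finset.mem_Icc, Finset.mem_Ico] at hx ⊢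
        omega
  · obtain ⟨h, rfl⟩ : Even r := by
      rcases Nat.even_mul.1 he with h | h
      · exact h
      · exact absurd h (by simp)
    refine exists_isDRegular_of_symm (Finset.Icc (h - k) (h + k)) ?_ ?_ ?_
    · intro x hx
      simp only [Finset.mem_Icc, Finset.mem_Ico] at hx ⊢
      omega
    · intro x hx
      simp only [Finset.mem_Icc] at hx ⊢
      omega
    · rw [Nat.card_Icc]
      omega

/-- The lift of the complete graph on `Fin m` along a family of permutations of `X`. -/
def completeLift {m : ℕ} {X : Type*} (σ : Fin m → Fin m → Equiv.Perm X) :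
    SimpleGraph (Fin m × X) where
  Adj p q := (p.1 < q.1 ∧ σ p.1 q.1 p.2 = q.2) ∨ (q.1 < p.1 ∧ σ q.1 p.1 q.2 = p.2)
  symm := ⟨fun _ _ h => h.symm⟩
  loopless := ⟨fun _ h => by simp at h⟩

lemma isDRegular_completeLift {d : ℕ} {X : Type*}
    (σ : Fin (d + 1) → Fin (d + 1) → Equiv.Perm X) : IsDRegular (completeLift σ) d := by
  rintro ⟨i, x⟩
  have h : ({i}ᶜ : Set (Fin (d + 1))).ncard = d := by
    rw [Set.ncard_compl]; simp
  refine Eq.trans ?_ h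
  refine Set.ncard_congr (fun p _ => p.1) ?_ ?_ ?_
  · rintro ⟨j, y⟩ (h | h)
    · exact h.1.ne'
    · exact h.1.ne
  · rintro ⟨j, y⟩ ⟨j', y'⟩ h h' (rfl : j = j')
    rcases h with ⟨h1, h2⟩ | ⟨h1, h2⟩ <;> rcases h' with ⟨h3, h4⟩ | ⟨h3, h4⟩
    · exact Prod.ext rfl (h2.symm.trans h4)
    · exact absurd h1 h3.asymm
    · exact absurd h1 h3.asymm
    · exact Prod.ext rfl ((σ j i).injective (h2.trans h4.symm))
  · intro j hj
    rcases lt_or_gt_of_ne hj with h | h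
    · exact ⟨(j, (σ j i).symm x), Or.inr ⟨h, by simp⟩, rfl⟩
    · exact ⟨(j, σ i j x), Or.inl ⟨h, rfl⟩, rfl⟩

lemma IsDRegular.sum {V W : Type*} {G : SimpleGraph V} {H : SimpleGraph W} {d : ℕ}
    (hG : IsDRegular G d) (hH : IsDRegular H d) : IsDRegular (G ⊕g H) d := by
  rintro (v | w)
  · have h : (G ⊕g H).neighborSet (Sum.inl v) = Sum.inl '' G.neighborSet v := by
      ext (u | u) <;> simp
    rw [h, Set.ncard_image_of_injective _ Sum.inl_injective, hG v]
  · have h : (G ⊕g H).neighborSet (Sum.inr w) = Sum.inr '' H.neighborSet w := by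
      ext (u | u) <;> simp
    rw [h, Set.ncard_image_of_injective _ Sum.inr_injective, hH w]

lemma IsDRegular.map_equiv {V W : Type*} {G : SimpleGraph V} {d : ℕ} (hG : IsDRegular G d)
    (e : V ≃ W) : IsDRegular (G.map e.toEmbedding) d := by
  intro w
  obtain ⟨v, rfl⟩ := e.surjective w
  rw [← hG v, ← Set.ncard_image_of_injective _ e.injective]
  congr 1
  ext u
  obtain ⟨u, rfl⟩ := e.surjective u
  have := SimpleGraph.map_adj_apply (G := G) (f := e.toEmbedding) (a := v) (b := u)
  simpa using this

lemma cliqueCount_le_map {V W : Type*} [Finite W] (G : SimpleGraph V) (f : V ↪ W) (k : ℕ) :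
    cliqueCount G k ≤ cliqueCount (G.map f) k :=
  Nat.card_le_card_of_injective (fun t => ⟨t.1.map f, t.2.map⟩) fun _ _ h =>
    Subtype.ext (Finset.map_injective f (Subtype.mk.inj h))

/-- The permutations, acting trivially on `Fin k`, prescribed by independent permutations of
`Fin m`. -/
def partialPerms {d k m : ℕ} (π : (j : Fin (d + 1)) → Fin j → Equiv.Perm (Fin m))
    (i j : Fin (d + 1)) : Equiv.Perm (Fin k ⊕ Fin m) :=
  Equiv.sumCongr 1 (if h : i < j then π j ⟨i, h⟩ else 1)

lemma completeLift_partialPerms_injective {d k m : ℕ} :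
    Function.Injective fun π : (j : Fin (d + 1)) → Fin j → Equiv.Perm (Fin m) =>
      completeLift (partialPerms (k := k) π) := by
  intro π ρ h
  ext j i x : 3
  have hij : (⟨i, i.2.trans j.2⟩ : Fin (d + 1)) < j := i.2
  have hadj : (completeLift (partialPerms (k := k) π)).Adj
      (⟨i, i.2.trans j.2⟩, Sum.inr x) (j, Sum.inr (π j i x)) :=
    Or.inl ⟨hij, by simp [partialPerms, hij]⟩
  rw [show completeLift (partialPerms (k := k) π) = completeLift (partialPerms ρ) from h] at hadj
  rcases hadj with ⟨-, h⟩ | ⟨h, -⟩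
  · simpa [partialPerms, hij] using h.symm
  · exact absurd hij h.asymm

lemma mul_choose_le_cliqueCount {d k m : ℕ} {W : Type*} [Finite W] (H : SimpleGraph W)
    (π : (j : Fin (d + 1)) → Fin j → Equiv.Perm (Fin m)) :
    k * (d + 1).choose 3 ≤ cliqueCount (completeLift (partialPerms (k := k) π) ⊕g H) 3 := by
  let ι (a : Fin k) : Fin (d + 1) ↪ (Fin (d + 1) × (Fin k ⊕ Fin m)) ⊕ W :=
    ⟨fun j => Sum.inl (j, Sum.inl a), fun i j h => by simpa using h⟩
  have hcard : Nat.card (Fin k × Finset.powersetCard 3 (Finset.univ : Finset (Fin (d + 1)))) =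
      k * (d + 1).choose 3 := by simp
  rw [← hcard]
  refine Nat.card_le_card_of_injective (fun p => ⟨p.2.1.map (ι p.1), ?_⟩) ?_
  · rw [SimpleGraph.isNClique_iff, Finset.card_map, (Finset.mem_powersetCard.1 p.2.2).2]
    refine ⟨?_, rfl⟩
    intro u hu v hv huv
    simp only [Finset.coe_map, Set.mem_image] at hu hv
    obtain ⟨i, -, rfl⟩ := hu
    obtain ⟨j, -, rfl⟩ := hv
    have hij : i ≠ j := fun h => huv (by rw [h])
    change (completeLift (partialPerms (k := k) π)).Adj (i, Sum.inl p.1) (j, Sum.inl p.1)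
    rcases lt_or_gt_of_ne hij with h | h
    · exact Or.inl ⟨h, by simp [partialPerms]⟩
    · exact Or.inr ⟨h, by simp [partialPerms]⟩
  · rintro ⟨a, s, hs⟩ ⟨b, t, ht⟩ h
    have h' : s.map (ι a) = t.map (ι b) := Subtype.mk.inj h
    have hne : s.Nonempty := by
      rw [← Finset.card_pos, (Finset.mem_powersetCard.1 hs).2]; norm_num
    obtain ⟨x, hx⟩ := hne
    have hab : a = b := by
      have : ι a x ∈ t.map (ι b) := h' ▸ Finset.mem_map_of_mem _ hx
      obtain ⟨y, -, hy⟩ := Finset.mem_map.1 this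
      have : y = x ∧ b = a := by simpa using (Sum.inl_injective hy :
        (y, (Sum.inl b : Fin k ⊕ Fin m)) = (x, Sum.inl a))
      exact this.2.symm
    subst hab
    have hst := Finset.map_injective _ h'
    subst hst
    rfl

/-- A disjoint union of `k` cliques, a lift of a clique and one further graph gives many
`d`-regular graphs with many triangles. -/
lemma factorial_pow_le_card_Gdc {n d k m r : ℕ} (hn : n = (d + 1) * (k + m) + r)
    (hr : d + 1 ≤ r) (he : Even (r * d)) {c : ℝ} (hc : c * n ≤ k * (d + 1)) :
    m.factorial ^ ((d + 1) * d / 2) ≤ Nat.card (Gdc n d c) := by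
  obtain ⟨H, hH⟩ := exists_isDRegular hr he
  let e : (Fin (d + 1) × (Fin k ⊕ Fin m)) ⊕ Fin r ≃ Fin n :=
    Fintype.equivFinOfCardEq (by simp [hn])
  have hcard : Nat.card ((j : Fin (d + 1)) → Fin j → Equiv.Perm (Fin m)) =
      m.factorial ^ ((d + 1) * d / 2) := by
    rw [Nat.card_eq_fintype_card, Fintype.card_pi]
    simp only [Fintype.card_fun, Fintype.card_perm, Fintype.card_fin]
    rw [Finset.prod_pow_eq_pow_sum, Fin.sum_univ_eq_sum_range (fun i => i), Finset.sum_range_id,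
      Nat.add_sub_cancel]
  rw [← hcard]
  refine Nat.card_le_card_of_injective (fun π =>
    ⟨(completeLift (partialPerms (k := k) π) ⊕g H).map e.toEmbedding, ?_, ?_⟩) ?_
  · exact ((isDRegular_completeLift _).sum hH).map_equiv e
  · have h1 := (mul_choose_le_cliqueCount (k := k) H π).trans (cliqueCount_le_map _ e.toEmbedding 3)
    have h2 : ((d : ℝ) + 1) * d.choose 2 = (d + 1).choose 3 * 3 := by
      exact_mod_cast Nat.add_one_mul_choose_eq d 2
    have h3 : (k : ℝ) * (d + 1).choose 3 ≤
        cliqueCount ((completeLift (partialPerms (k := k) π) ⊕g H).map e.toEmbedding) 3 := by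
      exact_mod_cast h1
    refine le_trans ?_ h3
    calc c * ((n : ℝ) / 3 * d.choose 2) = c * n * (d.choose 2 / 3) := by ring
      _ ≤ k * (d + 1) * (d.choose 2 / 3) := by gcongr
      _ = k * (((d : ℝ) + 1) * d.choose 2) / 3 := by ring
      _ = k * (d + 1).choose 3 := by rw [h2]; ring
  · intro π ρ h
    have h1 := SimpleGraph.map_injective e.toEmbedding (Subtype.mk.inj h)
    refine completeLift_partialPerms_injective (k := k) ?_
    ext p q
    have := congrArg (fun G => G.Adj (Sum.inl p) (Sum.inl q)) h1
    simpa using this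

lemma log_card_Gdc_le {n d : ℕ} (hn : 1 ≤ Real.log n) (hd : 2 ≤ d) {c : ℝ}
    (hpos : 0 < Nat.card (Gdc n d c)) :
    Real.log (Nat.card (Gdc n d c)) ≤ ((d : ℝ) * n / 2 * Real.log n) *
      (1 - c + 10 / √d + Real.log d / Real.log n) := by
  have hn1 : 1 ≤ n := by
    by_contra h
    obtain rfl : n = 0 := by omega
    norm_num at hn
  have hn0 : (0 : ℝ) < n := by exact_mod_cast hn1
  have hd2 : (2 : ℝ) ≤ d := by exact_mod_cast hd
  set L := Real.log n with hL
  set s := √(d : ℝ) with hs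
  have hs1 : 1 ≤ s := Real.one_le_sqrt.2 (by linarith)
  have hs0 : 0 < s := by linarith
  have hsd : s * s = d := Real.mul_self_sqrt (by positivity)
  set Q := (d : ℝ) * n / 2 with hQ
  have hQ0 : 0 < Q := by positivity
  have hup := card_Gdc_le hn1 hd c (K := d * s) (by positivity)
  have hK : Q / (d * s) * d = Q / s := by field_simp
  rw [← hQ, hK] at hup
  have hlog := Real.log_le_log (by exact_mod_cast hpos) hup
  rw [Real.log_mul (by positivity) (by positivity), Real.log_mul (by positivity) (by positivity),
    Real.log_mul (by positivity) (by positivity), Real.log_mul (by positivity) (by positivity),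
    Real.log_exp, Real.log_exp, Real.log_pow, Real.log_rpow hn0, Real.log_rpow (by linarith),
    ← hL] at hlog
  refine hlog.trans ?_
  have hu : Q / s ≤ Q / s * L := le_mul_of_one_le_right (by positivity) hn
  have h1 : n * Real.log 2 + n ≤ 4 * (Q / s * L) := by
    have h2 : (n : ℝ) * Real.log 2 + n ≤ 2 * n := by nlinarith [Real.log_two_lt_d9]
    have h3 : (n : ℝ) ≤ 2 * (Q / s) := by
      rw [hQ, ← hsd]
      field_simp
      linarith
    linarith
  have h2 : n * (d * s) / (d - 1) ≤ 4 * (Q / s) := by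
    rw [div_le_iff₀ (by linarith), hQ, ← hsd]
    field_simp
    nlinarith
  have h3 := mul_le_mul_of_nonneg_right h2 (by linarith : 0 ≤ L)
  have h4 : Q * L * (1 - c + 10 / s + Real.log d / L) =
      (1 - c) * Q * L + 10 * (Q / s * L) + Q * Real.log d := by
    field_simp
  rw [h4]
  linarith

lemma mul_log_sub_le_log_factorial {m : ℕ} (hm : 1 ≤ m) :
    m * (Real.log m - 1) ≤ Real.log m.factorial := by
  have hm0 : (0 : ℝ) < m := by exact_mod_cast hm
  have h := Real.pow_div_factorial_le_exp (m : ℝ) hm0.le m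
  rw [div_le_iff₀ (by positivity)] at h
  have h' := Real.log_le_log (by positivity) h
  rw [Real.log_pow, Real.log_mul (by positivity) (by positivity), Real.log_exp] at h'
  linarith

lemma le_log_card_Gdc {n d : ℕ} (he : Even (n * d)) {c : ℝ} (hc0 : 0 ≤ c) (hc1 : c < 1)
    (hy : 6 ≤ (1 - c) * ((n : ℝ) / (d + 1)))
    (hlog : 1 ≤ Real.log ((n : ℝ) / (d + 1)) + Real.log ((1 - c) / 2)) :
    0 < Nat.card (Gdc n d c) ∧
      ((d : ℝ) + 1) * d / 2 * (((1 - c) * ((n : ℝ) / (d + 1)) - 3) *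
        (Real.log ((n : ℝ) / (d + 1)) + Real.log ((1 - c) / 2) - 1)) ≤
      Real.log (Nat.card (Gdc n d c)) := by
  set y := (n : ℝ) / (d + 1) with hydef
  have hd1 : (0 : ℝ) < d + 1 := by positivity
  have hyn : y * (d + 1) = n := by rw [hydef]; field_simp
  have hθ : 0 < 1 - c := by linarith
  have hy0 : 0 < y := by
    by_contra h
    nlinarith
  set k := ⌈c * y⌉₊ with hk
  have hk1 : c * y ≤ k := Nat.le_ceil _
  have hk2 : (k : ℝ) < c * y + 1 := Nat.ceil_lt_add_one (by positivity)
  set t := n / (d + 1) with ht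
  have hdiv : (d + 1) * t + n % (d + 1) = n := Nat.div_add_mod _ _
  have hmod : n % (d + 1) < d + 1 := Nat.mod_lt _ (by omega)
  have ht1 : y < t + 1 := by
    rw [hydef, div_lt_iff₀ hd1]
    have : n < (t + 1) * (d + 1) := by nlinarith
    exact_mod_cast this
  have hkt : k + 1 ≤ t := by
    have : (k : ℝ) + 1 < t + 1 := by linarith
    have : k + 1 < t + 1 := by exact_mod_cast this
    omega
  obtain ⟨m, hm⟩ := Nat.exists_eq_add_of_le hkt
  have hmR : (t : ℝ) = k + 1 + m := by rw [hm]; push_cast; ring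
  have hm3 : (1 - c) * y - 3 ≤ m := by linarith
  have hm1 : 1 ≤ m := by
    have : (0 : ℝ) < m := by linarith
    exact_mod_cast this
  have hr : Even ((n % (d + 1) + (d + 1)) * d) := by
    have h1 : n * d = (d + 1) * d * t + n % (d + 1) * d := by
      conv_lhs => rw [← hdiv]
      ring
    have h2 : Even ((d + 1) * d) := by rw [mul_comm]; exact Nat.even_mul_succ_self d
    rw [h1] at he
    rw [add_mul]
    exact ((Nat.even_add.1 he).1 (h2.mul_right t)).add h2
  have hcard := factorial_pow_le_card_Gdc (n := n) (d := d) (k := k) (m := m) (c := c)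
    (r := n % (d + 1) + (d + 1)) (by rw [hm] at hdiv; linarith) (by omega) hr
    (by rw [← hyn, ← mul_assoc]; gcongr)
  have hpos : 0 < m.factorial ^ ((d + 1) * d / 2) := by positivity
  refine ⟨hpos.trans_le hcard, ?_⟩
  have hcard' : ((m.factorial : ℝ)) ^ ((d + 1) * d / 2) ≤ Nat.card (Gdc n d c) := by
    exact_mod_cast hcard
  refine le_trans ?_ (Real.log_le_log (by positivity) hcard')
  have hhalf : (((d + 1) * d / 2 : ℕ) : ℝ) = ((d : ℝ) + 1) * d / 2 := by
    have h2 : Even ((d + 1) * d) := by rw [mul_comm]; exact Nat.even_mul_succ_self d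
    rw [Nat.cast_div h2.two_dvd (by norm_num)]
    push_cast
    ring
  rw [Real.log_pow, hhalf]
  refine mul_le_mul_of_nonneg_left ?_ (by positivity)
  refine le_trans ?_ (mul_log_sub_le_log_factorial hm1)
  have hlogm : Real.log y + Real.log ((1 - c) / 2) ≤ Real.log m := by
    rw [← Real.log_mul hy0.ne' (by positivity)]
    exact Real.log_le_log (by positivity) (by linarith)
  exact mul_le_mul hm3 (by linarith) (by linarith) (by positivity)

lemma tendsto_log_natCast : Tendsto (fun n : ℕ => Real.log n) atTop atTop :=
  Real.tendsto_log_atTop.comp tendsto_natCast_atTop_atTop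

lemma tendsto_log_add_one_div_log {d : ℕ → ℕ} (hd : Tendsto d atTop atTop)
    (hlog : Tendsto (fun n : ℕ => Real.log (d n) / Real.log n) atTop (nhds 0)) :
    Tendsto (fun n : ℕ => Real.log ((d n : ℝ) + 1) / Real.log n) atTop (nhds 0) := by
  have h2 : Tendsto (fun n : ℕ => Real.log 2 / Real.log n + Real.log (d n) / Real.log n)
      atTop (nhds 0) := by
    simpa using (tendsto_log_natCast.const_div_atTop (Real.log 2)).add hlog
  refine squeeze_zero' ?_ ?_ h2
  · filter_upwards with n
    exact div_nonneg (Real.log_nonneg (by simp)) (Real.log_natCast_nonneg n)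
  · filter_upwards [hd.eventually_ge_atTop 1] with n hn
    have hn' : (1 : ℝ) ≤ d n := by exact_mod_cast hn
    rw [← add_div, ← Real.log_mul (by norm_num) (by positivity)]
    exact div_le_div_of_nonneg_right (Real.log_le_log (by positivity) (by linarith))
      (Real.log_natCast_nonneg n)

lemma tendsto_log_div_add_one {d : ℕ → ℕ} (hd : Tendsto d atTop atTop)
    (hlog : Tendsto (fun n : ℕ => Real.log (d n) / Real.log n) atTop (nhds 0)) :
    Tendsto (fun n : ℕ => Real.log ((n : ℝ) / ((d n : ℝ) + 1)) / Real.log n) atTop (nhds 1) := by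
  have h := (tendsto_const_nhds (x := (1 : ℝ))).sub (tendsto_log_add_one_div_log hd hlog)
  rw [sub_zero] at h
  refine h.congr' ?_
  filter_upwards [tendsto_log_natCast.eventually_gt_atTop 0, eventually_gt_atTop 0] with n hn hn0
  rw [Real.log_div (by positivity) (by positivity)]
  field_simp

lemma tendsto_log_natCast_div {d : ℕ → ℕ} (hd : Tendsto d atTop atTop)
    (hlog : Tendsto (fun n : ℕ => Real.log (d n) / Real.log n) atTop (nhds 0)) :
    Tendsto (fun n : ℕ => Real.log ((n : ℝ) / ((d n : ℝ) + 1))) atTop atTop := by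
  refine ((tendsto_log_div_add_one hd hlog).pos_mul_atTop one_pos tendsto_log_natCast).congr' ?_
  filter_upwards [tendsto_log_natCast.eventually_gt_atTop 0] with n hn
  field_simp

lemma tendsto_natCast_div {d : ℕ → ℕ} (hd : Tendsto d atTop atTop)
    (hlog : Tendsto (fun n : ℕ => Real.log (d n) / Real.log n) atTop (nhds 0)) :
    Tendsto (fun n : ℕ => (n : ℝ) / ((d n : ℝ) + 1)) atTop atTop := by
  refine (Real.tendsto_exp_atTop.comp (tendsto_log_natCast_div hd hlog)).congr' ?_
  filter_upwards [eventually_gt_atTop 0] with n hn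
  exact Real.exp_log (by positivity)

lemma eventually_le_log_card_Gdc {d : ℕ → ℕ} (hd : Tendsto d atTop atTop)
    (hlog : Tendsto (fun n : ℕ => Real.log (d n) / Real.log n) atTop (nhds 0))
    (heven : ∀ n : ℕ, Even (n * d n)) {c : ℝ} (hc0 : 0 ≤ c) (hc1 : c < 1) :
    ∀ᶠ n in atTop, 0 < Nat.card (Gdc n (d n) c) ∧
      ((d n : ℝ) + 1) * d n / 2 * (((1 - c) * ((n : ℝ) / (d n + 1)) - 3) *
        (Real.log ((n : ℝ) / (d n + 1)) + Real.log ((1 - c) / 2) - 1)) ≤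
      Real.log (Nat.card (Gdc n (d n) c)) := by
  have h1 := (tendsto_natCast_div hd hlog).const_mul_atTop (sub_pos.2 hc1)
  have h2 := tendsto_atTop_add_const_right _ (Real.log ((1 - c) / 2))
    (tendsto_log_natCast_div hd hlog)
  filter_upwards [h1.eventually_ge_atTop 6, h2.eventually_ge_atTop 1] with n h6 hl
  exact le_log_card_Gdc (heven n) hc0 hc1 h6 hl

/-- The logarithmic size of the set of `d`-regular graphs with a given proportion of triangles. -/
lemma tendsto_log_card_Gdc {d : ℕ → ℕ} (hd : Tendsto d atTop atTop)
    (hlog : Tendsto (fun n : ℕ => Real.log (d n) / Real.log n) atTop (nhds 0))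
    (heven : ∀ n : ℕ, Even (n * d n)) {c : ℝ} (hc0 : 0 ≤ c) (hc1 : c < 1) :
    Tendsto (fun n : ℕ => Real.log (Nat.card (Gdc n (d n) c)) /
      ((d n : ℝ) * n / 2 * Real.log n)) atTop (nhds (1 - c)) := by
  have hsqrt : Tendsto (fun n => √(d n : ℝ)) atTop atTop :=
    Real.tendsto_sqrt_atTop.comp (tendsto_natCast_atTop_atTop.comp hd)
  have hup : Tendsto (fun n : ℕ => 1 - c + 10 / √(d n : ℝ) + Real.log (d n) / Real.log n)
      atTop (nhds (1 - c)) := by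
    simpa using (tendsto_const_nhds.add (hsqrt.const_div_atTop 10)).add hlog
  have hlow : Tendsto (fun n : ℕ => (1 - c - 3 / ((n : ℝ) / (d n + 1))) *
      (Real.log ((n : ℝ) / (d n + 1)) / Real.log n + (Real.log ((1 - c) / 2) - 1) / Real.log n))
      atTop (nhds (1 - c)) := by
    simpa using (tendsto_const_nhds.sub ((tendsto_natCast_div hd hlog).const_div_atTop 3)).mul
      ((tendsto_log_div_add_one hd hlog).add
        (tendsto_log_natCast.const_div_atTop (Real.log ((1 - c) / 2) - 1)))
  have hev := eventually_le_log_card_Gdc hd hlog heven hc0 hc1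
  refine tendsto_of_tendsto_of_tendsto_of_le_of_le' hlow hup ?_ ?_
  · filter_upwards [hev, tendsto_log_natCast.eventually_ge_atTop 1, hd.eventually_ge_atTop 2,
      eventually_gt_atTop 0] with n h hn hdn hn0
    have hn0' : (0 : ℝ) < n := by exact_mod_cast hn0
    have hd0 : (0 : ℝ) < d n := by exact_mod_cast (by omega : 0 < d n)
    have hL : 0 < Real.log n := by linarith
    rw [le_div_iff₀ (by positivity)]
    refine le_of_eq_of_le ?_ h.2
    field_simp
    ring
  · filter_upwards [hev, tendsto_log_natCast.eventually_ge_atTop 1, hd.eventually_ge_atTop 2,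
      eventually_gt_atTop 0] with n h hn hdn hn0
    have hd0 : (0 : ℝ) < d n := by exact_mod_cast (by omega : 0 < d n)
    have hL : 0 < Real.log n := by linarith
    rw [div_le_iff₀ (by positivity), mul_comm]
    exact log_card_Gdc_le hn hdn h.1

lemma Gdc_zero (n d : ℕ) : Gdc n d 0 = Gd n d := by
  ext G
  simp [Gdc, Gd]

/-- Large deviations rate, growing `d`: for fixed `c ∈ (0,1)` and any sequence `d(n) → ∞`
with `log d(n) / log n → 0` and `n * d(n)` even for all `n`,
`(-log(|G_{d(n),c}(n)|/|G_{d(n)}(n)|)) / ((d(n) n/2) log(n/(d(n)+1))) → c`. -/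
theorem large_deviation_growing_d (c : ℝ) (hc0 : 0 < c) (hc1 : c < 1) (d : ℕ → ℕ)
    (hd_tendsto : Tendsto d atTop atTop)
    (hd_log : Tendsto (fun n : ℕ => Real.log (d n) / Real.log n) atTop (nhds 0))
    (hd_even : ∀ n : ℕ, Even (n * d n)) :
    Tendsto
      (fun n : ℕ =>
        (-Real.log ((Nat.card (Gdc n (d n) c) : ℝ) / (Nat.card (Gd n (d n)) : ℝ))) /
          (((d n : ℝ) * n / 2) * Real.log ((n : ℝ) / ((d n : ℝ) + 1))))
      atTop (nhds c) := by
  have hA := tendsto_log_card_Gdc hd_tendsto hd_log hd_even hc0.le hc1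
  have hB := tendsto_log_card_Gdc hd_tendsto hd_log hd_even le_rfl one_pos
  have h := (hB.sub hA).div (tendsto_log_div_add_one hd_tendsto hd_log) one_ne_zero
  simp only [Gdc_zero, sub_zero, sub_sub_cancel, div_one] at h
  refine h.congr' ?_
  filter_upwards [eventually_le_log_card_Gdc hd_tendsto hd_log hd_even hc0.le hc1,
    eventually_le_log_card_Gdc hd_tendsto hd_log hd_even le_rfl one_pos,
    tendsto_log_natCast.eventually_gt_atTop 0, hd_tendsto.eventually_gt_atTop 0,
    eventually_gt_atTop 0,
    (tendsto_log_natCast_div hd_tendsto hd_log).eventually_gt_atTop 0] with n h1 h2 hL hdn hn hy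
  rw [Gdc_zero] at h2
  have h1' : (Nat.card (Gdc n (d n) c) : ℝ) ≠ 0 := by exact_mod_cast h1.1.ne'
  have h2' : (Nat.card (Gd n (d n)) : ℝ) ≠ 0 := by exact_mod_cast h2.1.ne'
  rw [Real.log_div h1' h2', Pi.div_apply]
  field_simp
  ring
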